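/- Let μ be an ergodic structure and let χ(x̄) be a first-order formula in n free variables such that μ(χ(x̄)) > 0 and μ(p) = 0 for every complete first-order n-type p containing χ. Then μ is properly ergodic: every isomorphism class {N ∈ Str_L : N ≅ M} is μ-null. -/

import Mathlib

open FirstOrder Language MeasureTheory Set
open scoped ENNReal

namespace Ergo


/-- The space of L-structures with domain ℕ. -/
abbrev StrL (L : FirstOrder.Language.{0,0}) : Type :=
  ∀ n : ℕ, L.Relations n → (Fin n → ℕ) → Bool

variable (L : FirstOrder.Language.{0,0})

/-- The L-structure on ℕ coded by a point of `StrL L`. -/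
def toStructure [L.IsRelational] (x : StrL L) : L.Structure ℕ where
  funMap := fun f _ => isEmptyElim f
  RelMap := fun {n} r a => x n r a = true

/-- The logic action of a permutation of ℕ on `StrL L`. -/
def act (σ : Equiv.Perm ℕ) (x : StrL L) : StrL L :=
  fun n r a => x n r (fun i => σ.symm (a i))

/-- Satisfaction of a sentence at a point of `StrL L`. -/
def SatS [L.IsRelational] (x : StrL L) (φ : L.Sentence) : Prop :=
  letI := toStructure L x
  Sentence.Realize ℕ φ

/-- Satisfaction of a formula at a point of `StrL L` under an assignment. -/
def SatF [L.IsRelational] (x : StrL L) {n : ℕ} (φ : L.Formula (Fin n)) (a : Fin n → ℕ) : Prop :=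
  letI := toStructure L x
  Formula.Realize φ a

/-- `⟦φ⟧`, the set of structures satisfying the sentence φ. -/
def extS [L.IsRelational] (φ : L.Sentence) : Set (StrL L) := {x | SatS L x φ}

/-- `⟦φ(ā)⟧`, the set of structures satisfying φ(ā). -/
def extF [L.IsRelational] {n : ℕ} (φ : L.Formula (Fin n)) (a : Fin n → ℕ) : Set (StrL L) :=
  {x | SatF L x φ a}

/-- Invariance of a measure under the logic action. -/
def Invariant (μ : Measure (StrL L)) : Prop :=
  ∀ (σ : Equiv.Perm ℕ) (X : Set (StrL L)), MeasurableSet X → μ (act L σ '' X) = μ X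

/-- An ergodic structure: an ergodic invariant Borel probability measure on `StrL L`. -/
def IsErgodicStructure (μ : Measure (StrL L)) : Prop :=
  IsProbabilityMeasure μ ∧ Invariant L μ ∧
    ∀ X : Set (StrL L), MeasurableSet X →
      (∀ σ : Equiv.Perm ℕ, μ (symmDiff X (act L σ '' X)) = 0) → μ X = 0 ∨ μ X = 1

/-- The isomorphism class (orbit of the logic action) of a point of `StrL L`. -/
def IsoClass (M : StrL L) : Set (StrL L) := {N | ∃ σ : Equiv.Perm ℕ, act L σ M = N}

/-- All isomorphism classes are null: the defining property of proper ergodicity. -/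
def OrbitsNull (μ : Measure (StrL L)) : Prop := ∀ M : StrL L, μ (IsoClass L M) = 0

/-- Realization of a formula in an explicitly given structure. -/
def RealizeIn (M : Type) (iM : L.Structure M) {n : ℕ} (φ : L.Formula (Fin n))
    (a : Fin n → M) : Prop :=
  letI := iM
  Formula.Realize φ a

/-- Satisfaction of a sentence in an explicitly given structure. -/
def SatSIn (M : Type) (iM : L.Structure M) (φ : L.Sentence) : Prop :=
  letI := iM
  Sentence.Realize M φ

/-- A complete first-order n-type: the set of formulas satisfied by a fixed tuple
in some L-structure. -/
def IsCompleteType (n : ℕ) (p : Set (L.Formula (Fin n))) : Prop :=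
  ∃ (M : Type) (iM : L.Structure M) (a : Fin n → M), p = {φ | RealizeIn L M iM φ a}

/-- A complete quantifier-free n-type. -/
def IsQfCompleteType (n : ℕ) (p : Set (L.Formula (Fin n))) : Prop :=
  ∃ (M : Type) (iM : L.Structure M) (a : Fin n → M),
    p = {φ | φ.IsQF ∧ RealizeIn L M iM φ a}

/-- A type is non-redundant if it contains `xᵢ ≠ xⱼ` for all `i ≠ j`. -/
def NonRedundant (n : ℕ) (p : Set (L.Formula (Fin n))) : Prop :=
  ∀ i j : Fin n, i ≠ j → BoundedFormula.not (Term.equal (Term.var i) (Term.var j)) ∈ p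

/-- The set of structures in which the canonical distinct tuple (0,…,n−1) realizes p;
`μ` of this set is the measure `μ(p)` of the type `p`. -/
def typeSet [L.IsRelational] {n : ℕ} (p : Set (L.Formula (Fin n))) : Set (StrL L) :=
  {x | ∀ φ ∈ p, SatF L x φ (fun i => (i : ℕ))}

/-- Realization of (all formulas of) a type in an explicit structure by a tuple. -/
def RealizesTypeIn (M : Type) (iM : L.Structure M) {n : ℕ} (p : Set (L.Formula (Fin n)))
    (a : Fin n → M) : Prop :=
  ∀ φ ∈ p, RealizeIn L M iM φ a

/-- χ-rootedness with respect to quantifier-free types. -/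
def ChiRootedQfOn (M : Type) (iM : L.Structure M) {n : ℕ} (χ : L.Formula (Fin n)) : Prop :=
  ∀ p : Set (L.Formula (Fin n)), IsQfCompleteType L n p → NonRedundant L n p → χ ∈ p →
    (∃ a, RealizesTypeIn L M iM p a) →
    ∃ r : M, ∀ a, RealizesTypeIn L M iM p a → ∃ i, a i = r

/-- χ-rootedness with respect to complete first-order types. -/
def ChiRootedFullOn (M : Type) (iM : L.Structure M) {n : ℕ} (χ : L.Formula (Fin n)) : Prop :=
  ∀ p : Set (L.Formula (Fin n)), IsCompleteType L n p → NonRedundant L n p → χ ∈ p →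
    (∃ a, RealizesTypeIn L M iM p a) →
    ∃ r : M, ∀ a, RealizesTypeIn L M iM p a → ∃ i, a i = r

section Helpers

variable {L}

theorem act_act_symm (σ : Equiv.Perm ℕ) (x : StrL L) : act L σ (act L σ.symm x) = x := by
  funext m r a
  simp [act]

theorem act_mem_isoClass {M x : StrL L} (σ : Equiv.Perm ℕ) (hx : x ∈ IsoClass L M) :
    act L σ x ∈ IsoClass L M := by
  obtain ⟨τ, rfl⟩ := hx
  exact ⟨τ.trans σ, rfl⟩

theorem Invariant.measure_image_act_eq_zero {μ : Measure (StrL L)} (hμ : Invariant L μ)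
    (σ : Equiv.Perm ℕ) {X : Set (StrL L)} (hX : μ X = 0) : μ (act L σ '' X) = 0 := by
  refine measure_mono_null (image_mono (subset_toMeasurable μ X)) ?_
  rw [hμ σ _ (measurableSet_toMeasurable μ X), measure_toMeasurable, hX]

variable [L.IsRelational]

theorem satF_act (σ : Equiv.Perm ℕ) (x : StrL L) {n : ℕ} (φ : L.Formula (Fin n))
    (a : Fin n → ℕ) : SatF L (act L σ x) φ (σ ∘ a) ↔ SatF L x φ a := by
  let e : @FirstOrder.Language.Equiv L ℕ ℕ (toStructure L x) (toStructure L (act L σ x)) :=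
    @FirstOrder.Language.Equiv.mk L ℕ ℕ (toStructure L x) (toStructure L (act L σ x)) σ
      (fun f _ => isEmptyElim f)
      (fun r b => by
        change act L σ x _ r (σ ∘ b) = true ↔ x _ r b = true
        simp [act])
  let := toStructure L x
  exact @StrongHomClass.realize_formula L ℕ ℕ _ (toStructure L (act L σ x)) _ _ _ _ e φ a

theorem exists_term_realize_eq {β : Type} (t : L.Term β) (w : β → ℕ) :
    ∃ m, ∀ x : StrL L, @Term.realize L ℕ (toStructure L x) β w t = m := by
  cases t with
  | var i => exact ⟨w i, fun _ => rfl⟩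
  | func f _ => exact isEmptyElim f

theorem measurableSet_realize {α : Type} {k : ℕ} (φ : L.BoundedFormula α k) (v : α → ℕ)
    (xs : Fin k → ℕ) :
    MeasurableSet {x : StrL L | @BoundedFormula.Realize L ℕ (toStructure L x) α k φ v xs} := by
  induction φ with
  | falsum => exact MeasurableSet.empty
  | equal t₁ t₂ =>
    obtain ⟨m₁, h₁⟩ := exists_term_realize_eq t₁ (Sum.elim v xs)
    obtain ⟨m₂, h₂⟩ := exists_term_realize_eq t₂ (Sum.elim v xs)
    convert MeasurableSet.const (m₁ = m₂) using 3 with x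
    rw [← h₁ x, ← h₂ x]
    rfl
  | rel R ts =>
    choose m hm using fun i => exists_term_realize_eq (ts i) (Sum.elim v xs)
    have hmeas : MeasurableSet {x : StrL L | x _ R m = true} :=
      measurableSet_eq_fun (by fun_prop) measurable_const
    convert hmeas using 3 with x
    rw [← funext fun i => hm i x]
    rfl
  | imp f g hf hg =>
    simp only [BoundedFormula.realize_imp, imp_iff_not_or]
    exact (hf xs).compl.union (hg xs)
  | all f hf =>
    simp only [BoundedFormula.realize_all, ofPred_forall]
    exact MeasurableSet.iInter fun b => hf _

theorem measurableSet_extF {n : ℕ} (φ : L.Formula (Fin n)) (a : Fin n → ℕ) :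
    MeasurableSet (extF L φ a) :=
  measurableSet_realize φ a _

/-- The structures in an isomorphism class realize only countably many types, so a formula all of
whose completions are null defines a null subset of the class. -/
theorem measure_isoClass_inter_extF {μ : Measure (StrL L)} (M : StrL L) {n : ℕ}
    (χ : L.Formula (Fin n))
    (hnull : ∀ p : Set (L.Formula (Fin n)), IsCompleteType L n p → χ ∈ p →
      μ (typeSet L p) = 0) :
    μ (IsoClass L M ∩ extF L χ (fun i => (i : ℕ))) = 0 := by
  let p (a : Fin n → ℕ) : Set (L.Formula (Fin n)) := {φ | SatF L M φ a}
  refine measure_mono_null (t := ⋃ a ∈ {a : Fin n → ℕ | χ ∈ p a}, typeSet L (p a)) ?_ ?_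
  · rintro _ ⟨⟨σ, rfl⟩, hχ⟩
    have key (φ : L.Formula (Fin n)) :
        SatF L (act L σ M) φ (fun i => (i : ℕ)) ↔ SatF L M φ (σ.symm ∘ fun i => (i : ℕ)) := by
      rw [← satF_act σ M, ← Function.comp_assoc, Equiv.self_comp_symm, Function.id_comp]
    exact mem_biUnion ((key χ).1 hχ) fun φ hφ => (key φ).2 hφ
  · exact (measure_biUnion_null_iff (to_countable _)).2
      fun a ha => hnull _ ⟨ℕ, toStructure L M, a, rfl⟩ ha

end Helpers

/-- If μ is an ergodic structure and χ(x̄) is a first-order formula of positive measure such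
that every complete first-order n-type containing χ has measure 0, then μ is properly
ergodic: every isomorphism class is μ-null. -/
theorem statement6 [L.IsRelational] [∀ n, Countable (L.Relations n)]
    (μ : Measure (StrL L)) (hμ : IsErgodicStructure L μ)
    (n : ℕ) (χ : L.Formula (Fin n))
    (hpos : 0 < μ (extF L χ (fun i => (i : ℕ))))
    (hnull : ∀ p : Set (L.Formula (Fin n)), IsCompleteType L n p → χ ∈ p →
      μ (typeSet L p) = 0) :
    OrbitsNull L μ := by
  obtain ⟨hprob, hinv, herg⟩ := hμ
  intro M
  let std : Fin n → ℕ := fun i => (i : ℕ)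
  let B : Set (Fin n → ℕ) := {b | ∃ σ : Equiv.Perm ℕ, σ ∘ std = b}
  let Z : Set (StrL L) := ⋂ b ∈ B, (extF L χ b)ᶜ
  have hZmeas : MeasurableSet Z :=
    MeasurableSet.biInter (to_countable _) fun b _ => (measurableSet_extF χ b).compl
  have hZmaps (σ : Equiv.Perm ℕ) {x : StrL L} (hx : x ∈ Z) : act L σ x ∈ Z := by
    refine mem_iInter₂.2 ?_
    rintro _ ⟨τ, rfl⟩ h
    refine mem_iInter₂.1 hx (σ.symm ∘ τ ∘ std) ⟨τ.trans σ.symm, rfl⟩ ?_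
    refine (satF_act σ x χ _).1 ?_
    rwa [← Function.comp_assoc σ, Equiv.self_comp_symm, Function.id_comp]
  have hZinv (σ : Equiv.Perm ℕ) : act L σ '' Z = Z := by
    refine Subset.antisymm (image_subset_iff.2 fun x hx => hZmaps σ hx) fun x hx => ?_
    exact ⟨_, hZmaps σ.symm hx, act_act_symm σ x⟩
  have hZ : μ Z = 0 := by
    refine (herg Z hZmeas fun σ => by simp [hZinv σ]).resolve_right fun h => hpos.ne' ?_
    refine measure_mono_null (t := Zᶜ) (fun x hx hxZ => ?_) ((prob_compl_eq_zero_iff hZmeas).2 h)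
    exact mem_iInter₂.1 hxZ std ⟨Equiv.refl ℕ, rfl⟩ hx
  have hB : μ (⋃ b ∈ B, IsoClass L M ∩ extF L χ b) = 0 := by
    refine (measure_biUnion_null_iff (to_countable _)).2 ?_
    rintro _ ⟨σ, rfl⟩
    refine measure_mono_null ?_
      (hinv.measure_image_act_eq_zero σ (measure_isoClass_inter_extF M χ hnull))
    rintro x ⟨hxM, hx⟩
    refine ⟨act L σ.symm x, ⟨act_mem_isoClass σ.symm hxM, ?_⟩, act_act_symm σ x⟩
    refine (satF_act σ _ χ _).1 ?_
    rwa [act_act_symm]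
  refine measure_mono_null (fun x hx => ?_) (measure_union_null hZ hB)
  by_cases hxZ : x ∈ Z
  · exact Or.inl hxZ
  · simp only [Z, mem_iInter, not_forall, mem_compl_iff, not_not] at hxZ
    obtain ⟨b, hb, hxb⟩ := hxZ
    exact Or.inr (mem_biUnion hb ⟨hx, hxb⟩)

end Ergo
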